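/- Let n ≥ 3 and δ ∈ (0,(n−1)/(n+1)), and let R denote the split-merge regulation rule (the n-fold composition of the split-merge prerule Ř). Then there exists ε ∈ (0,1) such that inf { S^(ε)(R(μ)) − S^(ε)(μ) : μ ∈ Δ^n_+, μ_(1) = 1−δ } > 0, where S^(ε)(μ) = −Σ_{i=1}^n (μ_i + ε)·log(μ_i + ε) is the shifted entropy function. -/

import Mathlib

open scoped BigOperators

/-- The open unit simplex `Δ⁺ₙ`. -/
def simplexPos (n : ℕ) : Set (Fin n → ℝ) := {μ | (∀ i, 0 < μ i) ∧ ∑ i, μ i = 1}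

/-- The permutation `p` ranking the components of `μ` in decreasing order,
ties broken in increasing order of index (stable sort of `-μ`). -/
noncomputable def rankPerm {n : ℕ} (μ : Fin n → ℝ) : Equiv.Perm (Fin n) :=
  Tuple.sort (fun i => -μ i)

/-- The `k`-th reverse order statistic `μ₍ₖ₊₁₎` (0-indexed): `ordStat μ 0` is the
largest component, `ordStat μ (n-1)` the smallest. -/
noncomputable def ordStat {n : ℕ} (μ : Fin n → ℝ) (k : Fin n) : ℝ :=
  μ (rankPerm μ k)

/-- The split-merge prerule `Ř` with diversity parameter `δ`: if `μ₍₁₎ ≥ 1-δ`, the largest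
company (rank 1) is split in half, the new half being placed at the index of rank `n-1`,
whose previous two smallest values (ranks `n-1`, `n`) merge into the index of rank `n`;
otherwise (and when `n < 3`) it is the identity. -/
noncomputable def preRule {n : ℕ} (δ : ℝ) (μ : Fin n → ℝ) : Fin n → ℝ :=
  if hn : 3 ≤ n then
    if ordStat μ ⟨0, by omega⟩ < 1 - δ then μ
    else fun i =>
      if ((rankPerm μ).symm i : ℕ) = 0 then ordStat μ ⟨0, by omega⟩ / 2
      else if ((rankPerm μ).symm i : ℕ) = n - 2 then ordStat μ ⟨0, by omega⟩ / 2
      else if ((rankPerm μ).symm i : ℕ) = n - 1 then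
        ordStat μ ⟨n - 1, by omega⟩ + ordStat μ ⟨n - 2, by omega⟩
      else μ i
  else μ

/-- The entropy function `S(x) = -∑ xᵢ log xᵢ`. -/
noncomputable def entS {n : ℕ} (x : Fin n → ℝ) : ℝ := -∑ i, x i * Real.log (x i)

/-- The shifted entropy function `S⁽ᵉ⁾(μ) = -∑ (μᵢ+ε) log(μᵢ+ε)`. -/
noncomputable def shiftEnt {n : ℕ} (ε : ℝ) (μ : Fin n → ℝ) : ℝ :=
  -∑ i, (μ i + ε) * Real.log (μ i + ε)

theorem ordStat_antitone {n : ℕ} (μ : Fin n → ℝ) : Antitone (ordStat μ) := by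
  intro i j hij
  have h := Tuple.monotone_sort (fun i => -μ i) hij
  simpa [ordStat, rankPerm] using h

theorem sum_comp_ordStat {n : ℕ} (f : ℝ → ℝ) (μ : Fin n → ℝ) :
    ∑ k, f (ordStat μ k) = ∑ i, f (μ i) :=
  Equiv.sum_comp (rankPerm μ) fun i => f (μ i)

theorem le_ordStat_zero {n : ℕ} (hn : 0 < n) (μ : Fin n → ℝ) (i : Fin n) :
    μ i ≤ ordStat μ ⟨0, hn⟩ := by
  have h := ordStat_antitone μ
    (show (⟨0, hn⟩ : Fin n) ≤ (rankPerm μ).symm i from Nat.zero_le _)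
  simpa [ordStat] using h

theorem preRule_of_lt {n : ℕ} (hn : 3 ≤ n) {δ : ℝ} {μ : Fin n → ℝ}
    (h : ordStat μ ⟨0, by omega⟩ < 1 - δ) : preRule δ μ = μ := by
  simp [preRule, hn, h]

theorem preRule_pos {n : ℕ} {δ : ℝ} {μ : Fin n → ℝ} (hμ : ∀ i, 0 < μ i) (i : Fin n) :
    0 < preRule δ μ i := by
  have ho : ∀ k, 0 < ordStat μ k := fun k => hμ _
  unfold preRule
  split_ifs with h1 h2
  · exact hμ i
  · dsimp only
    split_ifs
    · exact half_pos (ho _)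
    · exact half_pos (ho _)
    · exact add_pos (ho _) (ho _)
    · exact hμ i
  · exact hμ i

/-- Effect of an active split-merge step on a separable functional. -/
theorem sum_comp_preRule {n : ℕ} (hn : 3 ≤ n) {δ : ℝ} {μ : Fin n → ℝ}
    (h : 1 - δ ≤ ordStat μ ⟨0, by omega⟩) (f : ℝ → ℝ) :
    ∑ i, f (preRule δ μ i) - ∑ i, f (μ i) =
      (f (ordStat μ ⟨0, by omega⟩ / 2) - f (ordStat μ ⟨0, by omega⟩)) +
      ((f (ordStat μ ⟨0, by omega⟩ / 2) - f (ordStat μ ⟨n - 2, by omega⟩)) +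
      (f (ordStat μ ⟨n - 1, by omega⟩ + ordStat μ ⟨n - 2, by omega⟩) -
        f (ordStat μ ⟨n - 1, by omega⟩))) := by
  have hlt : ¬ ordStat μ ⟨0, by omega⟩ < 1 - δ := not_lt.mpr h
  rw [← Finset.sum_sub_distrib,
    ← Equiv.sum_comp (rankPerm μ) fun i => f (preRule δ μ i) - f (μ i)]
  have h01 : (⟨0, by omega⟩ : Fin n) ≠ ⟨n - 2, by omega⟩ := by simp; omega
  have h02 : (⟨0, by omega⟩ : Fin n) ≠ ⟨n - 1, by omega⟩ := by simp; omega
  have h12 : (⟨n - 2, by omega⟩ : Fin n) ≠ ⟨n - 1, by omega⟩ := by simp; omega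
  have e1 : n - 2 ≠ 0 := by omega
  have e2 : n - 1 ≠ 0 := by omega
  have e3 : n - 1 ≠ n - 2 := by omega
  rw [← Finset.sum_subset (Finset.subset_univ
      {(⟨0, by omega⟩ : Fin n), ⟨n - 2, by omega⟩, ⟨n - 1, by omega⟩})]
  · rw [Finset.sum_insert (by simp only [Finset.mem_insert, Finset.mem_singleton]; tauto),
      Finset.sum_insert (by simpa only [Finset.mem_singleton] using h12),
      Finset.sum_singleton]
    simp only [preRule, dif_pos hn, if_neg hlt, Equiv.symm_apply_apply, if_true,
      if_neg e1, if_neg e2, if_neg e3]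
    rfl
  · intro k _ hk
    simp only [Finset.mem_insert, Finset.mem_singleton, Fin.ext_iff, not_or] at hk
    simp only [preRule, dif_pos hn, if_neg hlt, Equiv.symm_apply_apply,
      if_neg hk.1, if_neg hk.2.1, if_neg hk.2.2, sub_self]

theorem preRule_mem_simplexPos {n : ℕ} (hn : 3 ≤ n) {δ : ℝ} {μ : Fin n → ℝ}
    (hμ : μ ∈ simplexPos n) : preRule δ μ ∈ simplexPos n := by
  rcases lt_or_ge (ordStat μ ⟨0, by omega⟩) (1 - δ) with h | h
  · rwa [preRule_of_lt hn h]
  · refine ⟨preRule_pos hμ.1, ?_⟩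
    have hs := sum_comp_preRule hn h id
    have := hμ.2
    simp only [id] at hs
    linarith

theorem le_one_of_mem_simplexPos {n : ℕ} {μ : Fin n → ℝ} (hμ : μ ∈ simplexPos n) (i : Fin n) :
    μ i ≤ 1 :=
  hμ.2 ▸ Finset.single_le_sum (fun j _ => (hμ.1 j).le) (Finset.mem_univ i)

/-- The two smallest components sum to at most twice the average of all but the largest. -/
theorem ordStat_last_two_le {n : ℕ} (hn : 3 ≤ n) {μ : Fin n → ℝ} (hμ : μ ∈ simplexPos n) :
    ((n : ℝ) - 1) * (ordStat μ ⟨n - 1, by omega⟩ + ordStat μ ⟨n - 2, by omega⟩) ≤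
      2 * (1 - ordStat μ ⟨0, by omega⟩) := by
  set a := ordStat μ ⟨n - 2, by omega⟩
  have hba : ordStat μ ⟨n - 1, by omega⟩ ≤ a :=
    ordStat_antitone μ (Fin.mk_le_mk.mpr (by omega))
  have h02 : (⟨0, by omega⟩ : Fin n) ≠ ⟨n - 1, by omega⟩ := by simp; omega
  have hsub := Finset.sum_le_sum_of_subset_of_nonneg
    (f := fun k => ordStat μ k - a)
    (Finset.subset_univ {(⟨0, by omega⟩ : Fin n), ⟨n - 1, by omega⟩}) (by
      intro k _ hk
      simp only [Finset.mem_insert, Finset.mem_singleton, Fin.ext_iff, not_or] at hk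
      exact sub_nonneg.mpr (ordStat_antitone μ (Fin.mk_le_mk.mpr (by omega))))
  have hsum : ∑ k, ordStat μ k = 1 := (sum_comp_ordStat id μ).trans hμ.2
  rw [Finset.sum_pair h02, Finset.sum_sub_distrib, hsum] at hsub
  simp only [Finset.sum_const, Finset.card_univ, Fintype.card_fin, nsmul_eq_mul] at hsub
  have hn' : (3 : ℝ) ≤ n := by exact_mod_cast hn
  nlinarith [mul_nonneg (sub_nonneg.mpr hn') (sub_nonneg.mpr hba)]

theorem mul_log_add_mul_log_ge {a b : ℝ} (ha : 0 < a) (hb : 0 < b) :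
    (a + b) * Real.log (a + b) - (a + b) * Real.log 2 ≤
      a * Real.log a + b * Real.log b := by
  have h := Real.convexOn_mul_log.2 (Set.mem_Ici.mpr ha.le) (Set.mem_Ici.mpr hb.le)
    (by norm_num : (0 : ℝ) ≤ 1 / 2) (by norm_num : (0 : ℝ) ≤ 1 / 2) (by norm_num)
  simp only [smul_eq_mul] at h
  rw [show 1 / 2 * a + 1 / 2 * b = (a + b) / 2 by ring,
    Real.log_div (by positivity) two_ne_zero] at h
  linarith

/-- An active split-merge step increases the entropy by a definite amount. -/
theorem entS_preRule_ge {n : ℕ} (hn : 3 ≤ n) {δ : ℝ} {μ : Fin n → ℝ}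
    (hμ : μ ∈ simplexPos n) (h : 1 - δ ≤ ordStat μ ⟨0, by omega⟩) :
    entS μ + Real.log 2 * (1 - δ - 2 * δ / ((n : ℝ) - 1)) ≤ entS (preRule δ μ) := by
  have hs := sum_comp_preRule hn h fun x => x * Real.log x
  have hl := ordStat_last_two_le hn hμ
  have ho : ∀ k, 0 < ordStat μ k := fun k => hμ.1 _
  have hmerge := mul_log_add_mul_log_ge (ho ⟨n - 1, by omega⟩) (ho ⟨n - 2, by omega⟩)
  have hn' : (3 : ℝ) ≤ n := by exact_mod_cast hn
  have hbound : ordStat μ ⟨n - 1, by omega⟩ + ordStat μ ⟨n - 2, by omega⟩ ≤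
      2 * δ / ((n : ℝ) - 1) := by
    rw [le_div_iff₀ (by linarith)]
    linarith
  simp only [Real.log_div (ho ⟨0, by omega⟩).ne' two_ne_zero] at hs
  have hlog : 0 < Real.log 2 := Real.log_pos one_lt_two
  have hmul := mul_le_mul_of_nonneg_left (sub_le_sub h hbound) hlog.le
  unfold entS
  linarith

theorem entS_le_preRule {n : ℕ} (hn : 3 ≤ n) {δ : ℝ} (hδ : 0 ≤ 1 - δ - 2 * δ / ((n : ℝ) - 1))
    {μ : Fin n → ℝ} (hμ : μ ∈ simplexPos n) : entS μ ≤ entS (preRule δ μ) := by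
  rcases lt_or_ge (ordStat μ ⟨0, by omega⟩) (1 - δ) with h | h
  · rw [preRule_of_lt hn h]
  · linarith [entS_preRule_ge hn hμ h, mul_nonneg (Real.log_pos one_lt_two).le hδ]

theorem preRule_iterate {n : ℕ} (hn : 3 ≤ n) {δ : ℝ}
    (hδ : 0 ≤ 1 - δ - 2 * δ / ((n : ℝ) - 1)) {μ : Fin n → ℝ} (hμ : μ ∈ simplexPos n) (m : ℕ) :
    (preRule δ)^[m] μ ∈ simplexPos n ∧ entS μ ≤ entS ((preRule δ)^[m] μ) := by
  induction m with
  | zero => exact ⟨hμ, le_rfl⟩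
  | succ m ih =>
    rw [Function.iterate_succ_apply']
    exact ⟨preRule_mem_simplexPos hn ih.1, ih.2.trans (entS_le_preRule hn hδ ih.1)⟩

/-- The shifted entropy converges to the entropy uniformly on the open simplex. -/
theorem exists_shiftEnt_close (n : ℕ) {c : ℝ} (hc : 0 < c) :
    ∃ ε ∈ Set.Ioo (0 : ℝ) 1, ∀ μ ∈ simplexPos n, |shiftEnt ε μ - entS μ| ≤ c := by
  have huc := (isCompact_Icc (a := (0 : ℝ)) (b := 2)).uniformContinuousOn_of_continuous
    Real.continuous_mul_log.continuousOn
  obtain ⟨η, hη, hclose⟩ := Metric.uniformContinuousOn_iff.mp huc (c / (n + 1)) (by positivity)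
  have hε : 0 < min (η / 2) (1 / 2) := by positivity
  refine ⟨min (η / 2) (1 / 2), ⟨hε, (min_le_right _ _).trans_lt (by norm_num)⟩, ?_⟩
  intro μ hμ
  set ε := min (η / 2) (1 / 2)
  have hεη : ε ≤ η / 2 := min_le_left _ _
  have hε2 : ε ≤ 1 / 2 := min_le_right _ _
  have hterm : ∀ i, |μ i * Real.log (μ i) - (μ i + ε) * Real.log (μ i + ε)| ≤ c / (n + 1) := by
    intro i
    have h0 := hμ.1 i
    have h1 := le_one_of_mem_simplexPos hμ i
    refine (hclose (μ i) ⟨h0.le, by linarith⟩ (μ i + ε) ⟨by linarith, by linarith⟩ ?_).le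
    rw [dist_self_add_right, Real.norm_of_nonneg hε.le]
    linarith
  have heq : shiftEnt ε μ - entS μ =
      ∑ i, (μ i * Real.log (μ i) - (μ i + ε) * Real.log (μ i + ε)) := by
    rw [Finset.sum_sub_distrib, shiftEnt, entS]
    ring
  rw [heq]
  refine (Finset.abs_sum_le_sum_abs _ _).trans ((Finset.sum_le_sum fun i _ => hterm i).trans ?_)
  simp only [Finset.sum_const, Finset.card_univ, Fintype.card_fin, nsmul_eq_mul]
  rw [mul_div_assoc', div_le_iff₀ (by positivity)]
  linarith

theorem exists_mem_simplexPos_ordStat_eq {n : ℕ} (hn : 3 ≤ n) {δ : ℝ} (hδ0 : 0 < δ)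
    (hδ : δ / ((n : ℝ) - 1) ≤ 1 - δ) :
    ∃ μ ∈ simplexPos n, ordStat μ ⟨0, by omega⟩ = 1 - δ := by
  have hn' : (3 : ℝ) ≤ n := by exact_mod_cast hn
  have hq : 0 < δ / ((n : ℝ) - 1) := div_pos hδ0 (by linarith)
  let z : Fin n := ⟨0, by omega⟩
  let μ : Fin n → ℝ := Function.update (fun _ => δ / ((n : ℝ) - 1)) z (1 - δ)
  have hz : μ z = 1 - δ := Function.update_self ..
  have hne : ∀ i, i ≠ z → μ i = δ / ((n : ℝ) - 1) := fun i hi => Function.update_of_ne hi ..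
  have hle : ∀ i, μ i ≤ 1 - δ := by
    intro i
    rcases eq_or_ne i z with rfl | hi
    · exact hz.le
    · rwa [hne i hi]
  refine ⟨μ, ⟨fun i => ?_, ?_⟩, le_antisymm (hle _) (hz ▸ le_ordStat_zero _ μ z)⟩
  · rcases eq_or_ne i z with rfl | hi
    · rw [hz]; linarith
    · rwa [hne i hi]
  · rw [Finset.sum_update_of_mem (Finset.mem_univ z), Finset.sum_const,
      Finset.card_sdiff_of_subset (Finset.subset_univ _), Finset.card_univ, Fintype.card_fin,
      Finset.card_singleton, nsmul_eq_mul, Nat.cast_sub (by omega), Nat.cast_one,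
      mul_div_cancel₀ _ (by linarith)]
    ring

/-- For `n ≥ 3` and `δ ∈ (0,(n-1)/(n+1))` there is `ε ∈ (0,1)` such that
the infimum of the shifted-entropy increase `S⁽ᵉ⁾(R(μ)) - S⁽ᵉ⁾(μ)` over boundary points
`μ ∈ Δ⁺ₙ` with `μ₍₁₎ = 1-δ` is strictly positive, where `R` is the `n`-fold composition of
the split-merge prerule. -/
theorem shifted_entropy_increase_positive_inf
    (n : ℕ) (hn : 3 ≤ n) (δ : ℝ)
    (hδ : δ ∈ Set.Ioo (0 : ℝ) (((n : ℝ) - 1) / ((n : ℝ) + 1))) :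
    ∃ ε ∈ Set.Ioo (0 : ℝ) 1,
      0 < sInf ((fun μ => shiftEnt ε ((preRule δ)^[n] μ) - shiftEnt ε μ) ''
        {μ : Fin n → ℝ | μ ∈ simplexPos n ∧ ordStat μ ⟨0, by omega⟩ = 1 - δ}) := by
  obtain ⟨hδ0, hδ1⟩ := hδ
  have hn' : (3 : ℝ) ≤ n := by exact_mod_cast hn
  have hn1 : (0 : ℝ) < (n : ℝ) - 1 := by linarith
  rw [lt_div_iff₀ (by linarith)] at hδ1
  have hgap : 0 < 1 - δ - 2 * δ / ((n : ℝ) - 1) := by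
    rw [sub_pos, div_lt_iff₀ hn1]
    linarith
  have hc : 0 < Real.log 2 * (1 - δ - 2 * δ / ((n : ℝ) - 1)) :=
    mul_pos (Real.log_pos one_lt_two) hgap
  set c := Real.log 2 * (1 - δ - 2 * δ / ((n : ℝ) - 1))
  obtain ⟨ε, hε, hclose⟩ := exists_shiftEnt_close n (c := c / 4) (by positivity)
  refine ⟨ε, hε, (half_pos hc).trans_le (le_csInf ?_ ?_)⟩
  · obtain ⟨μ, hμ, hμ0⟩ := exists_mem_simplexPos_ordStat_eq hn hδ0 (by
      rw [div_le_iff₀ hn1]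
      linarith)
    exact ⟨_, μ, ⟨hμ, hμ0⟩, rfl⟩
  · rintro _ ⟨μ, ⟨hμ, hμ0⟩, rfl⟩
    obtain ⟨m, hm⟩ : ∃ m, n = m + 1 := ⟨n - 1, by omega⟩
    have hiter : (preRule δ)^[n] μ = (preRule δ)^[m] (preRule δ μ) :=
      (congrArg (fun k => (preRule δ)^[k] μ) hm).trans (Function.iterate_succ_apply _ _ _)
    have hstep := entS_preRule_ge hn hμ hμ0.ge
    have hrest := preRule_iterate hn hgap.le (preRule_mem_simplexPos (δ := δ) hn hμ) m
    rw [← hiter] at hrest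
    have h1 := abs_le.mp (hclose μ hμ)
    have h2 := abs_le.mp (hclose _ hrest.1)
    dsimp only
    linarith [hrest.2, h1.2, h2.1]
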